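/- Let R = ⊕_{n∈ℤ} R_n be a ℤ-graded ring. Then the Jacobson radical J(R) is a graded (homogeneous) ideal of R, i.e., if a ∈ J(R) then every homogeneous component of a lies in J(R). -/

import Mathlib

/-- The Jacobson radical of a ring `R`, i.e. the Jacobson radical of the zero
two-sided ideal. -/
noncomputable def jacobsonRadical (R : Type*) [Ring R] : TwoSidedIdeal R :=
  (⊥ : TwoSidedIdeal R).jacobson

open TensorProduct in
theorem aux_up {R B : Type*} [Ring R] [CommRing B] [Module.Finite ℤ B]
    (a : R) (ha : a ∈ Ring.jacobson R) :
    (a ⊗ₜ[ℤ] (1 : B)) ∈ Ring.jacobson (R ⊗[ℤ] B) := by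
  rw [← Ideal.jacobson_bot, Ideal.mem_jacobson_iff]
  intro y
  have key : ∀ t : R ⊗[ℤ] B, t * (a ⊗ₜ[ℤ] (1 : B)) ∈ Module.jacobson R (R ⊗[ℤ] B) := by
    intro t
    induction t using TensorProduct.induction_on with
    | zero => simp
    | add x y hx hy => rw [add_mul]; exact add_mem hx hy
    | tmul r b =>
      have h := Ring.jacobson_smul_top_le R (R ⊗[ℤ] B)
        (Submodule.smul_mem_smul (Ideal.mul_mem_left _ r ha)
          (Submodule.mem_top (x := ((1 : R) ⊗ₜ[ℤ] b))))
      simpa [TensorProduct.smul_tmul'] using h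
  let L : Ideal (R ⊗[ℤ] B) := Ideal.span {y * (a ⊗ₜ[ℤ] (1 : B)) + 1}
  have hL : L.restrictScalars R = ⊤ := by
    rcases eq_top_or_exists_le_coatom (L.restrictScalars R) with h | ⟨W, hW, hLW⟩
    · exact h
    · exfalso
      apply hW.1
      rw [eq_top_iff]
      intro t _
      have h1 : t * (y * (a ⊗ₜ[ℤ] (1 : B)) + 1) ∈ W :=
        hLW (L.mul_mem_left t (Ideal.subset_span rfl))
      have h2 : (t * y) * (a ⊗ₜ[ℤ] (1 : B)) ∈ W :=
        (sInf_le (a := W) hW : Module.jacobson R (R ⊗[ℤ] B) ≤ W) (key _)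
      have := W.sub_mem h1 h2
      rwa [mul_add, mul_one, mul_assoc, add_sub_cancel_left] at this
  have h1 : (1 : R ⊗[ℤ] B) ∈ L := by
    have : (1 : R ⊗[ℤ] B) ∈ L.restrictScalars R := hL ▸ Submodule.mem_top
    exact this
  obtain ⟨z, hz⟩ := Ideal.mem_span_singleton'.1 h1
  refine ⟨z, ?_⟩
  rw [Ideal.mem_bot, ← hz]
  noncomm_ring

open TensorProduct in
theorem aux_down {R B : Type*} [Ring R] [CommRing B] [Nontrivial B] [Module.Free ℤ B]
    (a : R) (ha : (a ⊗ₜ[ℤ] (1 : B)) ∈ Ring.jacobson (R ⊗[ℤ] B)) : a ∈ Ring.jacobson R := by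
  rw [← Ideal.jacobson_bot, Ideal.mem_jacobson_iff] at ha ⊢
  intro y
  obtain ⟨z, hz⟩ := ha (y ⊗ₜ 1)
  let e := Module.Free.chooseBasis ℤ B
  obtain ⟨i⟩ := e.index_nonempty
  let l : B →ₗ[ℤ] ℤ := (e.coord i).comp (LinearMap.mulRight ℤ (e i))
  have hl : l 1 = 1 := by simp [l]
  let f : R ⊗[ℤ] B →ₗ[ℤ] R :=
    (TensorProduct.rid ℤ R).toLinearMap.comp (TensorProduct.map LinearMap.id l)
  have hf : ∀ (r : R) (b : B), f (r ⊗ₜ b) = l b • r := by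
    intro r b
    change (TensorProduct.rid ℤ R) (TensorProduct.map LinearMap.id l (r ⊗ₜ b)) = _
    rw [TensorProduct.map_tmul, TensorProduct.rid_tmul, LinearMap.id_apply]
  have hfm : ∀ t (x : R), f (t * (x ⊗ₜ 1)) = f t * x := by
    intro t x
    induction t using TensorProduct.induction_on with
    | zero => simp
    | add u v hu hv => rw [add_mul, map_add, hu, hv, map_add, add_mul]
    | tmul r b => simp [hf, mul_assoc]
  refine ⟨f z, ?_⟩
  rw [Ideal.mem_bot] at hz ⊢
  have h := congrArg f hz
  rw [map_sub, map_add, hfm, hfm, map_zero, Algebra.TensorProduct.one_def, hf, hl, one_smul] at h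
  exact h

open TensorProduct in
noncomputable def auxCoact {R σ B : Type*} [Ring R] [SetLike σ R] [AddSubgroupClass σ R]
    (𝒜 : ℤ → σ) [GradedRing 𝒜] [CommRing B] (v : Bˣ) : R →+* R ⊗[ℤ] B :=
  (DirectSum.toSemiring (A := fun i => 𝒜 i)
    (fun i => (((TensorProduct.mk ℤ R B).flip ((v ^ i : Bˣ) : B)).toAddMonoidHom.comp
      (AddSubmonoidClass.subtype (𝒜 i)))) (by simp [Algebra.TensorProduct.one_def])
      (by
        intro i j x y
        simp [zpow_add])).comp
    (DirectSum.decomposeRingEquiv 𝒜).toRingHom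

open TensorProduct in
theorem auxCoact_of_mem {R σ B : Type*} [Ring R] [SetLike σ R] [AddSubgroupClass σ R]
    (𝒜 : ℤ → σ) [GradedRing 𝒜] [CommRing B] (v : Bˣ) (i : ℤ) (r : R) (hr : r ∈ 𝒜 i) :
    auxCoact 𝒜 v r = r ⊗ₜ ((v ^ i : Bˣ) : B) := by
  unfold auxCoact
  rw [RingHom.comp_apply]
  have : (DirectSum.decomposeRingEquiv 𝒜).toRingHom r = DirectSum.of (fun i => 𝒜 i) i ⟨r, hr⟩ :=
    DirectSum.decompose_of_mem 𝒜 hr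
  rw [this]
  exact DirectSum.toAddMonoid_of (fun i => (((TensorProduct.mk ℤ R B).flip
    ((v ^ i : Bˣ) : B)).toAddMonoidHom.comp (AddSubmonoidClass.subtype (𝒜 i)))) i ⟨r, hr⟩

open TensorProduct in
theorem auxCoact_jac {R σ B : Type*} [Ring R] [SetLike σ R] [AddSubgroupClass σ R]
    (𝒜 : ℤ → σ) [GradedRing 𝒜] [CommRing B] [Module.Finite ℤ B] (v : Bˣ)
    (a : R) (ha : a ∈ Ring.jacobson R) :
    auxCoact 𝒜 v a ∈ Ring.jacobson (R ⊗[ℤ] B) := by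
  let s : R ⊗[ℤ] B →ₐ[ℤ] R ⊗[ℤ] B := Algebra.TensorProduct.lift
    (auxCoact 𝒜 v).toIntAlgHom (Algebra.TensorProduct.includeRight) (by
      intro x y
      change auxCoact 𝒜 v x * (1 ⊗ₜ y) = (1 ⊗ₜ y) * auxCoact 𝒜 v x
      generalize auxCoact 𝒜 v x = t
      induction t using TensorProduct.induction_on with
      | zero => simp
      | add u v hu hv => rw [add_mul, mul_add, hu, hv]
      | tmul r b => simp [mul_comm])
  have hs : ∀ r b, s (r ⊗ₜ b) = auxCoact 𝒜 v r * (1 ⊗ₜ b) := by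
    intro r b
    exact Algebra.TensorProduct.lift_tmul _ _ _ _ _
  have surj : Function.Surjective s := by
    intro t
    induction t using TensorProduct.induction_on with
    | zero => exact ⟨0, map_zero _⟩
    | add u v hu hv =>
      obtain ⟨x, rfl⟩ := hu
      obtain ⟨y, rfl⟩ := hv
      exact ⟨x + y, map_add _ _ _⟩
    | tmul r b =>
      induction r using DirectSum.Decomposition.inductionOn 𝒜 with
      | zero => exact ⟨0, by simp⟩
      | @homogeneous i m =>
        refine ⟨m.1 ⊗ₜ (((v ^ (-i) : Bˣ) : B) * b), ?_⟩
        rw [hs, auxCoact_of_mem 𝒜 v i _ m.2]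
        simp [← mul_assoc, ← Units.val_mul]
      | add x y hx hy =>
        obtain ⟨x', hx⟩ := hx
        obtain ⟨y', hy⟩ := hy
        exact ⟨x' + y', by rw [map_add, hx, hy, TensorProduct.add_tmul]⟩
  have : RingHomSurjective s.toRingHom := ⟨surj⟩
  have h := Ring.le_comap_jacobson s.toRingHom (aux_up (B := B) a ha)
  have h2 : s (a ⊗ₜ 1) ∈ Ring.jacobson (R ⊗[ℤ] B) := h
  rw [hs] at h2
  rwa [← Algebra.TensorProduct.one_def, mul_one] at h2

open TensorProduct in
theorem aux_main {R σ B : Type*} [Ring R] [SetLike σ R] [AddSubgroupClass σ R]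
    (𝒜 : ℤ → σ) [GradedRing 𝒜] [CommRing B] [IsDomain B] [Module.Finite ℤ B] [Module.Free ℤ B]
    (N : ℕ) (u : Bˣ) (hu : IsPrimitiveRoot u N)
    (a : R) (ha : a ∈ Ring.jacobson R) (n : ℤ)
    (hN : ∀ j : ℤ, (DirectSum.decompose 𝒜 a j : R) ≠ 0 → |j - n| < N) :
    (N : R) * (DirectSum.decompose 𝒜 a n : R) ∈ Ring.jacobson R := by
  classical
  apply aux_down (B := B)
  have h1 : ∑ k ∈ Finset.range N, ((1 : R) ⊗ₜ[ℤ] (((u ^ (k : ℤ)) ^ (-n) : Bˣ) : B)) *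
      auxCoact 𝒜 (u ^ (k : ℤ)) a ∈ Ring.jacobson (R ⊗[ℤ] B) :=
    Ideal.sum_mem _ fun k _ => Ideal.mul_mem_left _ _ (auxCoact_jac 𝒜 _ a ha)
  convert h1 using 1
  have h2 : ∀ k : ℕ, ((1 : R) ⊗ₜ[ℤ] (((u ^ (k : ℤ)) ^ (-n) : Bˣ) : B)) *
      auxCoact 𝒜 (u ^ (k : ℤ)) a = ∑ j ∈ (DirectSum.decompose 𝒜 a).support,
        (DirectSum.decompose 𝒜 a j : R) ⊗ₜ[ℤ] (((u ^ (j - n)) ^ k : Bˣ) : B) := by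
    intro k
    conv_lhs => rw [← DirectSum.sum_support_decompose 𝒜 a]
    rw [map_sum, Finset.mul_sum]
    refine Finset.sum_congr rfl fun j _ => ?_
    rw [auxCoact_of_mem 𝒜 _ j _ (SetLike.coe_mem _), Algebra.TensorProduct.tmul_mul_tmul, one_mul,
      ← Units.val_mul, ← zpow_add, ← zpow_mul, ← zpow_natCast, ← zpow_mul]
    congr 3
    ring
  rw [Finset.sum_congr rfl fun k _ => h2 k, Finset.sum_comm]
  simp_rw [← TensorProduct.tmul_sum]
  have h3 : ∀ j : ℤ, j ≠ n → |j - n| < N →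
      ∑ k ∈ Finset.range N, (((u ^ (j - n)) ^ k : Bˣ) : B) = 0 := by
    intro j hj hjn
    have hne : ((u ^ (j - n) : Bˣ) : B) ≠ 1 := by
      intro h
      have h' : u ^ (j - n) = 1 := Units.ext h
      have hd := (hu.zpow_eq_one_iff_dvd _).1 h'
      exact hj (sub_eq_zero.1 (Int.eq_zero_of_abs_lt_dvd hd hjn))
    have hg := mul_geom_sum ((u ^ (j - n) : Bˣ) : B) N
    have hone : ((u ^ (j - n) : Bˣ) : B) ^ N = 1 := by
      rw [← Units.val_pow_eq_pow_val, ← zpow_natCast, ← zpow_mul, mul_comm, zpow_mul, zpow_natCast,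
        hu.pow_eq_one, one_zpow, Units.val_one]
    rw [hone, sub_self] at hg
    simpa using (mul_eq_zero.1 hg).resolve_left (sub_ne_zero.2 hne)
  rw [Finset.sum_eq_single n]
  · simp only [sub_self, zpow_zero, one_pow, Units.val_one, Finset.sum_const, Finset.card_range]
    rw [TensorProduct.tmul_smul, ← nsmul_eq_mul, TensorProduct.smul_tmul']
  · intro j hj hjn
    rw [h3 j hjn (hN j _), TensorProduct.tmul_zero]
    simpa using hj
  · intro hn
    have : (DirectSum.decompose 𝒜 a n : R) = 0 := by simpa using hn
    rw [this, TensorProduct.zero_tmul]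

theorem aux_main2 {R σ : Type*} [Ring R] [SetLike σ R] [AddSubgroupClass σ R]
    (𝒜 : ℤ → σ) [GradedRing 𝒜]
    (N : ℕ) (hN0 : N ≠ 0) 
    (a : R) (ha : a ∈ Ring.jacobson R) (n : ℤ)
    (hN : ∀ j : ℤ, (DirectSum.decompose 𝒜 a j : R) ≠ 0 → |j - n| < N) :
    (N : R) * (DirectSum.decompose 𝒜 a n : R) ∈ Ring.jacobson R := by
  have : NeZero N := ⟨hN0⟩
  have hc : @IsCyclotomicExtension {N} ℚ (CyclotomicField N ℚ) _ _
      (CyclotomicField.algebra N ℚ) := inferInstance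
  have := @IsCyclotomicExtension.numberField {N} ℚ (CyclotomicField N ℚ) _ _
    (CyclotomicField.algebra N ℚ) _ _ hc
  have hz := (@IsCyclotomicExtension.zeta_spec N _ ℚ (CyclotomicField N ℚ) _ _
    (CyclotomicField.algebra N ℚ) hc).toInteger_isPrimitiveRoot
  exact aux_main (B := NumberField.RingOfIntegers (CyclotomicField N ℚ)) 𝒜 N _
    (hz.isUnit_unit hN0) a ha n hN

/-- **Bergman's theorem, part (i)**: if `R = ⊕_{n ∈ ℤ} R_n` is a `ℤ`-graded ring, then the
Jacobson radical `J(R)` is a graded (homogeneous) ideal of `R`: for every `a ∈ J(R)` and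
every `n ∈ ℤ`, the degree-`n` homogeneous component of `a` lies in `J(R)`. -/
theorem jacobson_radical_homogeneous_of_zgraded
    {R σ : Type*} [Ring R] [SetLike σ R] [AddSubgroupClass σ R]
    (𝒜 : ℤ → σ) [GradedRing 𝒜]
    (a : R) (ha : a ∈ jacobsonRadical R) (n : ℤ) :
    (DirectSum.decompose 𝒜 a n : R) ∈ jacobsonRadical R := by
  classical
  have hj : ∀ x : R, x ∈ jacobsonRadical R ↔ x ∈ Ring.jacobson R := by
    intro x
    rw [← Ideal.jacobson_bot, Ideal.mem_jacobson_iff, jacobsonRadical,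
      TwoSidedIdeal.mem_jacobson_iff]
    simp [TwoSidedIdeal.mem_bot]
  rw [hj] at ha ⊢
  let N : ℕ := (∑ j ∈ (DirectSum.decompose 𝒜 a).support, (j - n).natAbs) + 1
  have hN : ∀ j : ℤ, (DirectSum.decompose 𝒜 a j : R) ≠ 0 → |j - n| < N := by
    intro j hj
    have hj' : j ∈ (DirectSum.decompose 𝒜 a).support := by simpa using hj
    have := Finset.single_le_sum (f := fun j : ℤ => (j - n).natAbs) (fun _ _ => Nat.zero_le _) hj'
    simp only at this
    rw [Int.abs_eq_natAbs]
    exact_mod_cast Nat.lt_succ_of_le this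
  have h1 := aux_main2 𝒜 N (Nat.succ_ne_zero _) a ha n hN
  have h2 := aux_main2 𝒜 (N + 1) (Nat.succ_ne_zero _) a ha n
    (fun j h => (hN j h).trans (by push_cast; omega))
  have := Ideal.sub_mem _ h2 h1
  rwa [Nat.cast_add, Nat.cast_one, add_mul, one_mul, add_sub_cancel_left] at this
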